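/- (Theorem 2(ii), sufficiency) Suppose α > 0, κ ≠ 0, n < 0, set η₀ = κ^{−1}(−1/n)^{1/α} and ζ₀ = F(η₀) = ((n−1)/n)^{(n−1)/α} κ^{−1} (−1/n)^{1/α}, and fix ε ∈ (0, ε₀]. If B_ε(Y) < ζ₀ for every Y ∈ [0,R], then the function V^ε(Y) = −∫_Y^R F^{−1}(B_ε(s)) ds, where F^{−1} : [0, ζ₀] → [0, η₀] is the inverse of the strictly increasing restriction of F to [0, η₀], is a classical solution of class C²([0,R]) of the regularized steady problem (1/(Y+ε)) d/dY[ (1 + κ^α |V'(Y)|^α)^{(n−1)/α} (Y+ε) V'(Y) ] = b(Y) on (0,R), V'(0) = 0, V(R) = 0, and it satisfies 0 ≤ (V^ε)'(Y) < η₀ for all Y ∈ [0,R]. -/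

import Mathlib

open Set Filter Real intervalIntegral

/-- The Carreau–Yasuda flux function `F(η) = (1 + κ^α |η|^α)^((n-1)/α) · η`. -/
noncomputable def Fcy (α κ n : ℝ) (η : ℝ) : ℝ :=
  (1 + κ ^ α * |η| ^ α) ^ ((n - 1) / α) * η

/-- The regularized averaged pressure gradient
`B_ε(Y) = (1/(Y+ε)) ∫₀^Y (s+ε) b(s) ds`. -/
noncomputable def Bf (b : ℝ → ℝ) (ε Y : ℝ) : ℝ :=
  (Y + ε)⁻¹ * ∫ s in (0:ℝ)..Y, (s + ε) * b s

/-- `V` solves the regularized steady problem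
`(1/(Y+ε)) d/dY[ (1+κ^α |V'|^α)^{(n-1)/α} (Y+ε) V' ] = b(Y)` on `(0,R)` with
`V'(0) = 0`, `V(R) = 0`, the derivatives being taken within `[0,R]`. -/
def IsSteadySol (α κ n R ε : ℝ) (b V : ℝ → ℝ) : Prop :=
  (∀ Y ∈ Ioo 0 R,
    HasDerivWithinAt
      (fun y => (1 + κ ^ α * |derivWithin V (Icc 0 R) y| ^ α) ^ ((n - 1) / α) *
        ((y + ε) * derivWithin V (Icc 0 R) y)) ((Y + ε) * b Y) (Icc 0 R) Y) ∧
  derivWithin V (Icc 0 R) 0 = 0 ∧ V R = 0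

/-- A left inverse of a continuous function on a compact set is continuous on the image. -/
lemma IsCompact.continuousOn_of_leftInvOn {X Y : Type*} [TopologicalSpace X] [TopologicalSpace Y]
    [T2Space Y] {f : X → Y} {g : Y → X} {s : Set X} (hs : IsCompact s) (hf : ContinuousOn f s)
    (hg : LeftInvOn g f s) : ContinuousOn g (f '' s) := by
  refine continuousOn_iff_isClosed.2 fun t ht => ⟨f '' (s ∩ t), ?_, ?_⟩
  · exact ((hs.inter_right ht).image_of_continuousOn (hf.mono inter_subset_left)).isClosed
  · ext y
    constructor
    · rintro ⟨hy, x, hx, rfl⟩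
      have hy' : g (f x) ∈ t := hy
      rw [hg hx] at hy'
      exact ⟨⟨x, ⟨hx, hy'⟩, rfl⟩, x, hx, rfl⟩
    · rintro ⟨⟨x, ⟨hx, hxt⟩, rfl⟩, hy⟩
      refine ⟨?_, hy⟩
      change g (f x) ∈ t
      rwa [hg hx]

/-- One-variable inverse function theorem for derivatives within a set. -/
lemma HasDerivWithinAt.of_local_left_inverse {f g : ℝ → ℝ} {s t : Set ℝ} {f' a : ℝ}
    (hg : Tendsto g (nhdsWithin a t) (nhdsWithin (g a) s))
    (hf : HasDerivWithinAt f f' s (g a)) (hf' : f' ≠ 0) (ha : a ∈ t)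
    (hfg : ∀ᶠ y in nhdsWithin a t, f (g y) = y) : HasDerivWithinAt g f'⁻¹ t a := by
  have hf₁ : HasFDerivWithinAt f
      (ContinuousLinearEquiv.unitsEquivAut ℝ (Units.mk0 f' hf') : ℝ →L[ℝ] ℝ) s (g a) :=
    hf.hasFDerivWithinAt.congr_fderiv (by ext; simp)
  exact (HasFDerivWithinAt.of_local_left_inverse hg hf₁ ha hfg).hasDerivWithinAt.congr_deriv
    (by simp)

lemma ContinuousOn.hasDerivWithinAt_integral_right {f : ℝ → ℝ} {a b x : ℝ}
    (hf : ContinuousOn f (Icc a b)) (hx : x ∈ Icc a b) :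
    HasDerivWithinAt (fun u => ∫ t in a..u, f t) (f x) (Icc a b) x := by
  have : Fact (x ∈ Icc a b) := ⟨hx⟩
  refine integral_hasDerivWithinAt_right ?_ ?_ (hf x hx)
  · exact (hf.mono (Icc_subset_Icc_right hx.2)).intervalIntegrable_of_Icc hx.1
  · exact hf.stronglyMeasurableAtFilter_nhdsWithin measurableSet_Icc x

lemma ContinuousOn.hasDerivWithinAt_integral_left {f : ℝ → ℝ} {a b x : ℝ}
    (hf : ContinuousOn f (Icc a b)) (hx : x ∈ Icc a b) :
    HasDerivWithinAt (fun u => ∫ t in u..b, f t) (-f x) (Icc a b) x := by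
  have : Fact (x ∈ Icc a b) := ⟨hx⟩
  refine integral_hasDerivWithinAt_left ?_ ?_ (hf x hx)
  · exact (hf.mono (Icc_subset_Icc_left hx.1)).intervalIntegrable_of_Icc hx.2
  · exact hf.stronglyMeasurableAtFilter_nhdsWithin measurableSet_Icc x

/-- The base `1 + κ^α |η|^α` of the viscosity is at least one. -/
lemma one_le_one_add_rpow_mul_abs_rpow {α κ : ℝ} (hκ : 0 ≤ κ) (η : ℝ) :
    1 ≤ 1 + κ ^ α * |η| ^ α :=
  le_add_of_nonneg_right (mul_nonneg (rpow_nonneg hκ _) (rpow_nonneg (abs_nonneg _) _))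

lemma continuous_one_add_rpow_mul_abs_rpow {α : ℝ} (hα : 0 < α) (κ : ℝ) :
    Continuous fun η : ℝ => 1 + κ ^ α * |η| ^ α :=
  continuous_const.add (continuous_const.mul (continuous_abs.rpow_const fun _ => Or.inr hα.le))

lemma continuous_one_add_rpow_mul_abs_rpow_rpow {α κ : ℝ} (hα : 0 < α) (hκ : 0 ≤ κ) (p : ℝ) :
    Continuous fun η : ℝ => (1 + κ ^ α * |η| ^ α) ^ p :=
  (continuous_one_add_rpow_mul_abs_rpow hα κ).rpow_const fun η =>
    Or.inl (zero_lt_one.trans_le (one_le_one_add_rpow_mul_abs_rpow hκ η)).ne'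

lemma continuous_Fcy {α κ : ℝ} (hα : 0 < α) (hκ : 0 ≤ κ) (n : ℝ) : Continuous (Fcy α κ n) :=
  (continuous_one_add_rpow_mul_abs_rpow_rpow hα hκ _).mul continuous_id

/-- The derivative of the Carreau–Yasuda flux function on `[0, ∞)`. -/
noncomputable def FcyDeriv (α κ n η : ℝ) : ℝ :=
  (1 + κ ^ α * |η| ^ α) ^ ((n - 1) / α - 1) * (1 + n * (κ ^ α * |η| ^ α))

lemma continuous_FcyDeriv {α κ : ℝ} (hα : 0 < α) (hκ : 0 ≤ κ) (n : ℝ) :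
    Continuous (FcyDeriv α κ n) :=
  (continuous_one_add_rpow_mul_abs_rpow_rpow hα hκ _).mul <|
    continuous_const.add <| continuous_const.mul <|
      continuous_const.mul (continuous_abs.rpow_const fun _ => Or.inr hα.le)

lemma hasDerivAt_Fcy {α κ : ℝ} (hα : 0 < α) (hκ : 0 ≤ κ) (n : ℝ) {η : ℝ} (hη : 0 ≤ η) :
    HasDerivAt (Fcy α κ n) (FcyDeriv α κ n η) η := by
  rcases hη.eq_or_lt with rfl | hη
  · have hc := (continuous_one_add_rpow_mul_abs_rpow_rpow (α := α) hα hκ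
      ((n - 1) / α)).tendsto 0
    rw [hasDerivAt_iff_tendsto_slope]
    refine (hc.mono_left nhdsWithin_le_nhds).congr' ?_ |>.trans_eq ?_
    · filter_upwards [self_mem_nhdsWithin] with x hx
      have hx0 : x ≠ 0 := hx
      simp only [slope, Fcy, vsub_eq_sub, smul_eq_mul]
      field_simp
      simp
    · simp [FcyDeriv, zero_rpow hα.ne']
  · have hpos : 0 < 1 + κ ^ α * η ^ α := by
      simpa [abs_of_pos hη] using
        zero_lt_one.trans_le (one_le_one_add_rpow_mul_abs_rpow (α := α) hκ η)
    have h₁ : HasDerivAt (fun x : ℝ => (1 + κ ^ α * x ^ α) ^ ((n - 1) / α) * x)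
        (FcyDeriv α κ n η) η := by
      have h₂ := ((((hasDerivAt_rpow_const (p := α) (Or.inl hη.ne')).const_mul (κ ^ α)).const_add
        1).rpow_const (p := (n - 1) / α) (Or.inl hpos.ne')).mul (hasDerivAt_id η)
      refine h₂.congr_deriv ?_
      have e₁ : η ^ (α - 1) * η = η ^ α := by
        rw [← rpow_add_one hη.ne', sub_add_cancel]
      have e₂ : (1 + κ ^ α * η ^ α) ^ ((n - 1) / α) =
          (1 + κ ^ α * η ^ α) ^ ((n - 1) / α - 1) * (1 + κ ^ α * η ^ α) := by
        rw [← rpow_add_one hpos.ne', sub_add_cancel]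
      have e₃ : α * ((n - 1) / α) = n - 1 := by field_simp
      simp only [FcyDeriv, abs_of_pos hη, id]
      rw [e₂]
      generalize (1 + κ ^ α * η ^ α) ^ ((n - 1) / α - 1) = A at *
      generalize (n - 1) / α = p at *
      linear_combination (κ ^ α * A * α * p) * e₁ + κ ^ α * A * η ^ α * e₃
    refine h₁.congr_of_eventuallyEq ?_
    filter_upwards [lt_mem_nhds hη] with x hx
    simp [Fcy, abs_of_pos hx]

/-- The flux function has positive derivative below the critical shear rate. -/
lemma FcyDeriv_pos {α κ n η : ℝ} (hα : 0 < α) (hκ : 0 < κ) (hn : n < 0) (hη : 0 ≤ η)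
    (h : η < κ⁻¹ * (-1 / n) ^ (1 / α)) : 0 < FcyDeriv α κ n η := by
  have hnn : 0 < -1 / n := div_pos_of_neg_of_neg (by norm_num) hn
  have h₁ : κ * η < (-1 / n) ^ (1 / α) := by
    rwa [inv_mul_eq_div, lt_div_iff₀' hκ] at h
  have h₂ : (κ * η) ^ α < -1 / n := by
    have := rpow_lt_rpow (mul_nonneg hκ.le hη) h₁ hα
    rwa [← rpow_mul hnn.le, one_div_mul_cancel hα.ne', rpow_one] at this
  rw [mul_rpow hκ.le hη, lt_div_iff_of_neg hn] at h₂
  refine mul_pos (rpow_pos_of_pos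
    (zero_lt_one.trans_le (one_le_one_add_rpow_mul_abs_rpow hκ.le η)) _) ?_
  rw [abs_of_nonneg hη]
  linarith

lemma hasDerivWithinAt_Bf {b : ℝ → ℝ} {ε R Y : ℝ} (hε : 0 < ε) (hb : ContinuousOn b (Icc 0 R))
    (hY : Y ∈ Icc 0 R) :
    HasDerivWithinAt (Bf b ε) (b Y - (Y + ε)⁻¹ * Bf b ε Y) (Icc 0 R) Y := by
  have hY₀ : Y + ε ≠ 0 := (add_pos_of_nonneg_of_pos hY.1 hε).ne'
  have hc : ContinuousOn (fun s => (s + ε) * b s) (Icc 0 R) :=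
    ((continuous_id.add continuous_const).continuousOn).mul hb
  have h := (((hasDerivWithinAt_id Y (Icc 0 R)).add_const ε).fun_inv hY₀).mul
    (hc.hasDerivWithinAt_integral_right hY)
  refine h.congr_deriv ?_
  simp only [Bf, id]
  field_simp
  ring

lemma Bf_zero (b : ℝ → ℝ) (ε : ℝ) : Bf b ε 0 = 0 := by simp [Bf]

lemma add_mul_Bf {b : ℝ → ℝ} {ε Y : ℝ} (hY : Y + ε ≠ 0) :
    (Y + ε) * Bf b ε Y = ∫ s in (0:ℝ)..Y, (s + ε) * b s := by
  rw [Bf, mul_inv_cancel_left₀ hY]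

lemma Bf_nonneg {b : ℝ → ℝ} {ε R Y : ℝ} (hε : 0 < ε) (hb : ∀ s ∈ Icc 0 R, 0 ≤ b s)
    (hY : Y ∈ Icc 0 R) : 0 ≤ Bf b ε Y := by
  refine mul_nonneg (inv_nonneg.2 (add_nonneg hY.1 hε.le)) ?_
  exact integral_nonneg hY.1 fun s hs =>
    mul_nonneg (add_nonneg hs.1 hε.le) (hb s ⟨hs.1, hs.2.trans hY.2⟩)


/-- Theorem 2(ii), sufficiency: for `α > 0`, `κ ≠ 0`, `n < 0`,
`η₀ = κ⁻¹(−1/n)^{1/α}`, `ζ₀ = F(η₀) = ((n−1)/n)^{(n−1)/α} κ⁻¹ (−1/n)^{1/α}`,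
`ε ∈ (0,ε₀]`: if `B_ε(Y) < ζ₀` on `[0,R]`, then
`V^ε(Y) = −∫_Y^R F⁻¹(B_ε(s)) ds`, with `F⁻¹ : [0,ζ₀] → [0,η₀]` the inverse of the
strictly increasing restriction of `F` to `[0,η₀]`, is a `C²([0,R])` classical
solution of the regularized steady problem, and `0 ≤ (V^ε)'(Y) < η₀` on `[0,R]`. -/
theorem stmt6 (α κ n R b₀ ε₀ ε : ℝ) (b G : ℝ → ℝ)
    (hα : 0 < α) (hκ : 0 ≤ κ) (hκ' : κ ≠ 0) (hn : n < 0)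
    (hR : 0 < R) (hε₀ : 0 < ε₀) (hε₀R : ε₀ < R) (hε : ε ∈ Ioc 0 ε₀)
    (hb : ContDiffOn ℝ 2 b (Icc 0 R))
    (hbb : ∀ Y ∈ Icc 0 R, 0 ≤ b Y ∧ b Y ≤ b₀)
    (hbne : ∃ Y ∈ Ioo 0 R, b Y ≠ 0) :
    ∀ η₀ ζ₀, η₀ = κ⁻¹ * (-1 / n) ^ (1 / α) →
      ζ₀ = ((n - 1) / n) ^ ((n - 1) / α) * κ⁻¹ * (-1 / n) ^ (1 / α) →
      ζ₀ = Fcy α κ n η₀ →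
      StrictMonoOn (Fcy α κ n) (Icc 0 η₀) →
      MapsTo (Fcy α κ n) (Icc 0 η₀) (Icc 0 ζ₀) →
      InvOn G (Fcy α κ n) (Icc 0 η₀) (Icc 0 ζ₀) →
      (∀ Y ∈ Icc 0 R, Bf b ε Y < ζ₀) →
      ContDiffOn ℝ 2 (fun Y => -∫ s in Y..R, G (Bf b ε s)) (Icc 0 R) ∧
      IsSteadySol α κ n R ε b (fun Y => -∫ s in Y..R, G (Bf b ε s)) ∧
      ∀ Y ∈ Icc 0 R,
        0 ≤ derivWithin (fun y => -∫ s in y..R, G (Bf b ε s)) (Icc 0 R) Y ∧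
        derivWithin (fun y => -∫ s in y..R, G (Bf b ε s)) (Icc 0 R) Y < η₀ := by
  intro η₀ ζ₀ hη₀ _ hζ₀ _ hmaps hinv hB
  have hκp : 0 < κ := lt_of_le_of_ne hκ hκ'.symm
  have hεp : 0 < ε := hε.1
  have hη₀p : 0 < η₀ := by
    rw [hη₀]
    exact mul_pos (inv_pos.2 hκp)
      (rpow_pos_of_pos (div_pos_of_neg_of_neg (by norm_num) hn) _)
  have hF0 : Fcy α κ n 0 = 0 := by simp [Fcy]
  have himage : Fcy α κ n '' Icc 0 η₀ = Icc 0 ζ₀ := by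
    refine hmaps.image_subset.antisymm ?_
    have := intermediate_value_Icc hη₀p.le (continuous_Fcy hα hκ n).continuousOn
    rwa [hF0, ← hζ₀] at this
  have hGmaps : MapsTo G (Icc 0 ζ₀) (Icc 0 η₀) := by
    rw [← himage]
    rintro _ ⟨η, hη, rfl⟩
    rwa [hinv.1 hη]
  have hGcont : ContinuousOn G (Icc 0 ζ₀) := by
    rw [← himage]
    exact isCompact_Icc.continuousOn_of_leftInvOn (continuous_Fcy hα hκ n).continuousOn hinv.1
  have hGlt : ∀ a ∈ Ico 0 ζ₀, G a < η₀ := by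
    intro a ha
    have ha' : a ∈ Icc 0 ζ₀ := Ico_subset_Icc_self ha
    refine lt_of_le_of_ne (hGmaps ha').2 fun h => ha.2.ne ?_
    rw [← hinv.2 ha', h, ← hζ₀]
  have hGpos : ∀ a ∈ Ico 0 ζ₀, 0 < FcyDeriv α κ n (G a) := fun a ha =>
    FcyDeriv_pos hα hκp hn (hGmaps (Ico_subset_Icc_self ha)).1 (hη₀ ▸ hGlt a ha)
  have hGderiv : ∀ a ∈ Ico 0 ζ₀,
      HasDerivWithinAt G (FcyDeriv α κ n (G a))⁻¹ (Icc 0 ζ₀) a := by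
    intro a ha
    have ha' : a ∈ Icc 0 ζ₀ := Ico_subset_Icc_self ha
    refine HasDerivWithinAt.of_local_left_inverse (s := Icc 0 η₀) ?_
      (hasDerivAt_Fcy hα hκ n (hGmaps ha').1).hasDerivWithinAt (hGpos a ha).ne' ha' ?_
    · exact (hGcont a ha').tendsto_nhdsWithin hGmaps
    · filter_upwards [self_mem_nhdsWithin] with y hy using hinv.2 hy
  have hBmaps : MapsTo (Bf b ε) (Icc 0 R) (Ico 0 ζ₀) := fun Y hY =>
    ⟨Bf_nonneg hεp (fun s hs => (hbb s hs).1) hY, hB Y hY⟩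
  have hBmaps' : MapsTo (Bf b ε) (Icc 0 R) (Icc 0 ζ₀) := hBmaps.mono_right Ico_subset_Icc_self
  have hbc : ContinuousOn b (Icc 0 R) := hb.continuousOn
  have hBderiv := fun Y (hY : Y ∈ Icc 0 R) => hasDerivWithinAt_Bf hεp hbc hY
  have hBcont : ContinuousOn (Bf b ε) (Icc 0 R) := fun Y hY => (hBderiv Y hY).continuousWithinAt
  have hwcont : ContinuousOn (fun s => G (Bf b ε s)) (Icc 0 R) := hGcont.comp hBcont hBmaps'
  have hwderiv : ∀ Y ∈ Icc 0 R, HasDerivWithinAt (fun s => G (Bf b ε s))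
      ((FcyDeriv α κ n (G (Bf b ε Y)))⁻¹ * (b Y - (Y + ε)⁻¹ * Bf b ε Y)) (Icc 0 R) Y :=
    fun Y hY => (hGderiv _ (hBmaps hY)).comp Y (hBderiv Y hY) hBmaps'
  have hVderiv : ∀ Y ∈ Icc 0 R, HasDerivWithinAt (fun Y => -∫ s in Y..R, G (Bf b ε s))
      (G (Bf b ε Y)) (Icc 0 R) Y := fun Y hY => by
    simpa using (hwcont.hasDerivWithinAt_integral_left hY).fun_neg
  have hud : UniqueDiffOn ℝ (Icc 0 R) := uniqueDiffOn_Icc hR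
  have hV : EqOn (derivWithin (fun Y => -∫ s in Y..R, G (Bf b ε s)) (Icc 0 R))
      (fun s => G (Bf b ε s)) (Icc 0 R) := fun Y hY => (hVderiv Y hY).derivWithin (hud Y hY)
  have h0 : (0 : ℝ) ∈ Icc 0 R := left_mem_Icc.2 hR.le
  refine ⟨?_, ⟨fun Y hY => ?_, ?_, by simp⟩, fun Y hY => ?_⟩
  · rw [show (2 : WithTop ℕ∞) = 1 + 1 by norm_num, contDiffOn_succ_iff_derivWithin hud]
    refine ⟨fun Y hY => (hVderiv Y hY).differentiableWithinAt, by simp, ?_⟩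
    refine ContDiffOn.congr ?_ hV
    rw [contDiffOn_one_iff_derivWithin hud]
    refine ⟨fun Y hY => (hwderiv Y hY).differentiableWithinAt, ?_⟩
    refine ContinuousOn.congr ?_ fun Y hY => (hwderiv Y hY).derivWithin (hud Y hY)
    refine (((continuous_FcyDeriv hα hκ n).comp_continuousOn hwcont).inv₀
      fun Y hY => (hGpos _ (hBmaps hY)).ne').mul (hbc.sub (ContinuousOn.mul ?_ hBcont))
    exact (continuous_id.add continuous_const).continuousOn.inv₀
      fun Y hY => (add_pos_of_nonneg_of_pos hY.1 hεp).ne'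
  · have hY' := Ioo_subset_Icc_self hY
    have hc : ContinuousOn (fun s => (s + ε) * b s) (Icc 0 R) :=
      ((continuous_id.add continuous_const).continuousOn).mul hbc
    have hflux : EqOn (fun y => (1 + κ ^ α *
          |derivWithin (fun Y => -∫ s in Y..R, G (Bf b ε s)) (Icc 0 R) y| ^ α) ^ ((n - 1) / α) *
          ((y + ε) * derivWithin (fun Y => -∫ s in Y..R, G (Bf b ε s)) (Icc 0 R) y))
        (fun y => ∫ s in (0:ℝ)..y, (s + ε) * b s) (Icc 0 R) := fun y hy => by
      have hF : Fcy α κ n (G (Bf b ε y)) = Bf b ε y := hinv.2 (hBmaps' hy)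
      simp only [hV hy]
      rw [← add_mul_Bf (add_pos_of_nonneg_of_pos hy.1 hεp).ne']
      rw [Fcy] at hF
      linear_combination (y + ε) * hF
    exact (hc.hasDerivWithinAt_integral_right hY').congr hflux (hflux hY')
  · rw [hV h0]
    simp only [Bf_zero]
    simpa only [hF0] using hinv.1 (left_mem_Icc.2 hη₀p.le)
  · rw [hV hY]
    exact ⟨(hGmaps (hBmaps' hY)).1, hGlt _ (hBmaps hY)⟩
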